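/- arXiv:2408.03788 — 2 statements merged into one kernel-verified Lean document; each statement's English description precedes it below -/
import Mathlib

section
/- For every integer N ≥ 2 there exists δ₀ > 0 such that for every δ ∈ (0, δ₀) there exists l ∈ (1, N) with l ≤ ℋ₁'(s)·s / ℋ₁(s) ≤ N for all s ≠ 0; in particular, 0 ≤ ℋ₁(s) ≤ ℋ₁'(s)·s ≤ N·ℋ₁(s) for all s ∈ ℝ. -/
/-- The function `ℋ₁` of the paper. -/
noncomputable def H1 (N : ℕ) (δ : ℝ) (s : ℝ) : ℝ :=
  if s = 0 then 0
  else if |s| < ((N : ℝ) - 1) * δ then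
    -(1 / (N : ℝ)) * |s| ^ N * Real.log (|s| ^ N)
  else
    -(1 / (N : ℝ)) * |s| ^ N * (Real.log ((((N : ℝ) - 1) * δ) ^ N) + N + 1)
      + (N : ℝ) * δ * |s| ^ (N - 1)
      - (((N : ℝ) - 1) * δ) ^ N / ((N : ℝ) * ((N : ℝ) - 1))

/-- The function `ℋ₂` of the paper. -/
noncomputable def H2 (N : ℕ) (δ : ℝ) (s : ℝ) : ℝ :=
  if |s| ≤ ((N : ℝ) - 1) * δ then 0
  else
    (1 / (N : ℝ)) * |s| ^ N * Real.log (|s| ^ N / (((N : ℝ) - 1) * δ) ^ N)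
      + (N : ℝ) * δ * |s| ^ (N - 1)
      - (((N : ℝ) + 1) / (N : ℝ)) * |s| ^ N
      - (((N : ℝ) - 1) * δ) ^ N / ((N : ℝ) * ((N : ℝ) - 1))

open Filter Topology

/-- Two functions with the same value and the same derivative at `a`, glued at `a`. -/
theorem HasDerivAt.of_eventually_le_of_eventually_ge {f g h : ℝ → ℝ} {d a : ℝ}
    (hg : HasDerivAt g d a) (hh : HasDerivAt h d a)
    (hfg : ∀ᶠ x in 𝓝 a, x ≤ a → f x = g x) (hfh : ∀ᶠ x in 𝓝 a, a ≤ x → f x = h x) :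
    HasDerivAt f d a := by
  have hle : HasDerivWithinAt f d (Set.Iic a) a :=
    hg.hasDerivWithinAt.congr_of_eventuallyEq (eventually_nhdsWithin_iff.2 hfg)
      (hfg.self_of_nhds le_rfl)
  have hge : HasDerivWithinAt f d (Set.Ici a) a :=
    hh.hasDerivWithinAt.congr_of_eventuallyEq (eventually_nhdsWithin_iff.2 hfh)
      (hfh.self_of_nhds le_rfl)
  simpa [Set.Iic_union_Ici, hasDerivWithinAt_univ] using hle.union hge

theorem hasDerivAt_pow_mul_log_pow {N : ℕ} (hN : N ≠ 0) {t : ℝ} (ht : 0 < t) :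
    HasDerivAt (fun x : ℝ => -(1 / (N : ℝ)) * x ^ N * Real.log (x ^ N))
      (-t ^ (N - 1) * (Real.log (t ^ N) + 1)) t := by
  have hN' : (N : ℝ) ≠ 0 := Nat.cast_ne_zero.2 hN
  have hp := hasDerivAt_pow N t
  have ht' : t ^ N ≠ 0 := (pow_pos ht N).ne'
  refine ((hp.const_mul (-(1 / (N : ℝ)))).mul (hp.log ht')).congr_deriv ?_
  field_simp
  ring

theorem hasDerivAt_pow_add_pow_pred {N : ℕ} (hN : 2 ≤ N) (A B C t : ℝ) :
    HasDerivAt (fun x : ℝ => -(1 / (N : ℝ)) * x ^ N * A + (N : ℝ) * B * x ^ (N - 1) - C)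
      (-t ^ (N - 1) * A + (N : ℝ) * (((N : ℝ) - 1) * B) * t ^ (N - 2)) t := by
  have hN' : (N : ℝ) ≠ 0 := by positivity
  refine (((((hasDerivAt_pow N t).const_mul (-(1 / (N : ℝ)))).mul_const A).add
    ((hasDerivAt_pow (N - 1) t).const_mul ((N : ℝ) * B))).sub_const C).congr_deriv ?_
  rw [Nat.cast_sub (by lia : 1 ≤ N), Nat.sub_sub]
  push_cast
  field_simp

theorem H1_of_lt {N : ℕ} {δ t : ℝ} (ht : 0 < t) (h : t < ((N : ℝ) - 1) * δ) :
    H1 N δ t = -(1 / (N : ℝ)) * t ^ N * Real.log (t ^ N) := by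
  simp [H1, ht.ne', abs_of_pos ht, h]

theorem H1_of_ge {N : ℕ} {δ t : ℝ} (ht : 0 < t) (h : ((N : ℝ) - 1) * δ ≤ t) :
    H1 N δ t = -(1 / (N : ℝ)) * t ^ N * (Real.log ((((N : ℝ) - 1) * δ) ^ N) + N + 1)
      + (N : ℝ) * δ * t ^ (N - 1) - (((N : ℝ) - 1) * δ) ^ N / ((N : ℝ) * ((N : ℝ) - 1)) := by
  simp [H1, ht.ne', abs_of_pos ht, h.not_gt]

theorem H1_zero (N : ℕ) (δ : ℝ) : H1 N δ 0 = 0 := by simp [H1]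

theorem H1_neg (N : ℕ) (δ s : ℝ) : H1 N δ (-s) = H1 N δ s := by simp [H1]

theorem deriv_H1_neg_mul (N : ℕ) (δ s : ℝ) :
    deriv (H1 N δ) (-s) * -s = deriv (H1 N δ) s * s := by
  have h := deriv_comp_neg (H1 N δ) s
  simp only [H1_neg] at h
  change deriv (H1 N δ) s = _ at h
  rw [h]
  ring

/-- The two branches of `H1` agree at the junction. -/
theorem H1_junction {N : ℕ} (hN : 2 ≤ N) {δ : ℝ} (hδ : 0 < δ) :
    H1 N δ (((N : ℝ) - 1) * δ) = -(1 / (N : ℝ)) * (((N : ℝ) - 1) * δ) ^ N *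
      Real.log ((((N : ℝ) - 1) * δ) ^ N) := by
  have hN2 : (2 : ℝ) ≤ N := by exact_mod_cast hN
  have hN1 : (N : ℝ) - 1 ≠ 0 := by linarith
  have ha : 0 < ((N : ℝ) - 1) * δ := mul_pos (by linarith) hδ
  rw [H1_of_ge ha le_rfl]
  have hδ' : δ = (((N : ℝ) - 1) * δ) / ((N : ℝ) - 1) := by field_simp
  generalize ((N : ℝ) - 1) * δ = a at *
  rw [hδ', ← mul_pow_sub_one (by lia : N ≠ 0) a]
  field_simp
  ring

theorem hasDerivAt_H1_of_le {N : ℕ} (hN : 2 ≤ N) {δ t : ℝ} (hδ : 0 < δ) (ht : 0 < t)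
    (h : t ≤ ((N : ℝ) - 1) * δ) :
    HasDerivAt (H1 N δ) (-t ^ (N - 1) * (Real.log (t ^ N) + 1)) t := by
  have hinner := hasDerivAt_pow_mul_log_pow (by lia : N ≠ 0) ht
  rcases h.lt_or_eq with h | rfl
  · refine hinner.congr_of_eventuallyEq ?_
    filter_upwards [Ioo_mem_nhds ht h] with x hx using H1_of_lt hx.1 hx.2
  · refine hinner.of_eventually_le_of_eventually_ge
      ((hasDerivAt_pow_add_pow_pred hN (Real.log ((((N : ℝ) - 1) * δ) ^ N) + N + 1) δ
        ((((N : ℝ) - 1) * δ) ^ N / ((N : ℝ) * ((N : ℝ) - 1))) _).congr_deriv ?_) ?_ ?_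
    · have hpow := mul_pow_sub_one (by lia : N - 1 ≠ 0) (((N : ℝ) - 1) * δ)
      rw [Nat.sub_sub] at hpow
      linear_combination (N : ℝ) * hpow
    · filter_upwards [lt_mem_nhds ht] with x hx hxa
      rcases hxa.lt_or_eq with hxa | rfl
      · exact H1_of_lt hx hxa
      · exact H1_junction hN hδ
    · filter_upwards [lt_mem_nhds ht] with x hx hxa using H1_of_ge hx hxa

theorem hasDerivAt_H1_of_gt {N : ℕ} (hN : 2 ≤ N) {δ t : ℝ} (ht : 0 < t)
    (h : ((N : ℝ) - 1) * δ < t) :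
    HasDerivAt (H1 N δ) (-t ^ (N - 1) * (Real.log ((((N : ℝ) - 1) * δ) ^ N) + N + 1)
      + (N : ℝ) * (((N : ℝ) - 1) * δ) * t ^ (N - 2)) t := by
  refine (hasDerivAt_pow_add_pow_pred hN _ δ
    ((((N : ℝ) - 1) * δ) ^ N / ((N : ℝ) * ((N : ℝ) - 1))) t).congr_of_eventuallyEq ?_
  filter_upwards [lt_mem_nhds h, lt_mem_nhds ht] with x hx hx0 using H1_of_ge hx0 hx.le

/-- For small `δ`, `H1` dominates `s ^ N`, which controls the defect in Euler's identity. -/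
theorem H1_bounds_of_pos {N : ℕ} (hN : 2 ≤ N) {δ t : ℝ} (hδ : 0 < δ)
    (hlog : Real.log (((N : ℝ) - 1) * δ) ≤ -6) (ht : 0 < t) :
    4 * t ^ N ≤ H1 N δ t ∧ deriv (H1 N δ) t * t ≤ N * H1 N δ t ∧
      N * H1 N δ t ≤ deriv (H1 N δ) t * t + 2 * t ^ N := by
  have hN2 : (2 : ℝ) ≤ N := by exact_mod_cast hN
  have hN1 : 0 < (N : ℝ) - 1 := by linarith
  have ha : 0 < ((N : ℝ) - 1) * δ := mul_pos hN1 hδ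
  have htN : 0 < t ^ N := pow_pos ht N
  have hpow : t * t ^ (N - 1) = t ^ N := mul_pow_sub_one (by lia) t
  rcases le_or_gt t (((N : ℝ) - 1) * δ) with h | h
  · have hH : H1 N δ t = -(1 / (N : ℝ)) * t ^ N * Real.log (t ^ N) := by
      rcases h.lt_or_eq with h | rfl
      · exact H1_of_lt ht h
      · exact H1_junction hN hδ
    have hlt : Real.log t ≤ -6 := (Real.log_le_log ht h).trans hlog
    have hH' : H1 N δ t = t ^ N * -Real.log t := by
      rw [hH, Real.log_pow]
      field_simp
    have hD : deriv (H1 N δ) t * t = N * H1 N δ t - t ^ N := by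
      rw [(hasDerivAt_H1_of_le hN hδ ht h).deriv, hH', Real.log_pow]
      linear_combination (-(N * Real.log t) - 1) * hpow
    refine ⟨?_, by linarith, by linarith⟩
    rw [hH']
    nlinarith
  · have hpow₂ : t * t ^ (N - 2) = t ^ (N - 1) := by
      have := mul_pow_sub_one (by lia : N - 1 ≠ 0) t
      rwa [Nat.sub_sub] at this
    have hH := H1_of_ge ht h.le
    have hD := (hasDerivAt_H1_of_gt hN ht h).deriv
    have hδ' : δ = (((N : ℝ) - 1) * δ) / ((N : ℝ) - 1) := by field_simp
    have hapow : (((N : ℝ) - 1) * δ) ^ N ≤ (((N : ℝ) - 1) * δ) * t ^ (N - 1) := by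
      rw [← mul_pow_sub_one (by lia : N ≠ 0) (((N : ℝ) - 1) * δ)]
      gcongr
    have hat : (((N : ℝ) - 1) * δ) * t ^ (N - 1) ≤ t ^ N := by
      rw [← hpow]
      gcongr
    have hap : 0 < (((N : ℝ) - 1) * δ) ^ N := pow_pos ha N
    rw [Real.log_pow] at hH hD
    generalize hadef : ((N : ℝ) - 1) * δ = a at *
    have hE : N * H1 N δ t - deriv (H1 N δ) t * t
        = (N * (a * t ^ (N - 1)) - a ^ N) / ((N : ℝ) - 1) := by
      rw [hH, hD, hδ', ← hpow, ← hpow₂]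
      field_simp
      ring
    have hlow : H1 N δ t = t ^ N * (-(N * Real.log a + N + 1) / N)
        + (N ^ 2 * (a * t ^ (N - 1)) - a ^ N) / (N * ((N : ℝ) - 1)) := by
      rw [hH, hδ']
      field_simp
      ring
    have hEnonneg : 0 ≤ (N * (a * t ^ (N - 1)) - a ^ N) / ((N : ℝ) - 1) :=
      div_nonneg (by nlinarith) hN1.le
    have hEle : (N * (a * t ^ (N - 1)) - a ^ N) / ((N : ℝ) - 1) ≤ 2 * t ^ N := by
      rw [div_le_iff₀ hN1]
      nlinarith
    refine ⟨?_, by linarith, by linarith⟩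
    have hc : 4 ≤ -(N * Real.log a + N + 1) / (N : ℝ) := by
      rw [le_div_iff₀ (by linarith)]
      nlinarith
    have hrem : 0 ≤ (N ^ 2 * (a * t ^ (N - 1)) - a ^ N) / (N * ((N : ℝ) - 1)) :=
      div_nonneg (by nlinarith [one_le_pow₀ (n := 2) (by linarith : (1 : ℝ) ≤ N)])
        (by nlinarith)
    rw [hlow]
    nlinarith

theorem H1_bounds {N : ℕ} (hN : 2 ≤ N) {δ s : ℝ} (hδ : 0 < δ)
    (hlog : Real.log (((N : ℝ) - 1) * δ) ≤ -6) (hs : s ≠ 0) :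
    0 < H1 N δ s ∧ deriv (H1 N δ) s * s ≤ N * H1 N δ s ∧
      ((N : ℝ) - 1 / 2) * H1 N δ s ≤ deriv (H1 N δ) s * s := by
  wlog hpos : 0 < s generalizing s
  · have h := this (neg_ne_zero.2 hs) (neg_pos.2 (hs.lt_of_le (not_lt.1 hpos)))
    rwa [deriv_H1_neg_mul, H1_neg] at h
  obtain ⟨h₁, h₂, h₃⟩ := H1_bounds_of_pos hN hδ hlog hpos
  have := pow_pos hpos N
  exact ⟨by linarith, h₂, by linarith⟩

/-- For `δ` small enough there is `l ∈ (1, N)` with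
`l ≤ H1'(s)·s / H1(s) ≤ N` for all `s ≠ 0`; in particular
`0 ≤ H1(s) ≤ H1'(s)·s ≤ N·H1(s)` for all `s`. -/
theorem stmt_12 (N : ℕ) (hN : 2 ≤ N) :
    ∃ δ₀ > (0 : ℝ), ∀ δ ∈ Set.Ioo (0 : ℝ) δ₀,
      ∃ l : ℝ, 1 < l ∧ l < (N : ℝ) ∧
        (∀ s : ℝ, s ≠ 0 →
          l ≤ deriv (H1 N δ) s * s / H1 N δ s ∧
          deriv (H1 N δ) s * s / H1 N δ s ≤ (N : ℝ)) ∧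
        (∀ s : ℝ,
          0 ≤ H1 N δ s ∧ H1 N δ s ≤ deriv (H1 N δ) s * s ∧
          deriv (H1 N δ) s * s ≤ (N : ℝ) * H1 N δ s) := by
  have hN2 : (2 : ℝ) ≤ N := by exact_mod_cast hN
  have hN1 : 0 < (N : ℝ) - 1 := by linarith
  refine ⟨Real.exp (-6) / ((N : ℝ) - 1), by positivity, fun δ ⟨hδ, hδ₀⟩ =>
    ⟨(N : ℝ) - 1 / 2, by linarith, by linarith, fun s hs => ?_, fun s => ?_⟩⟩
  all_goals
    have hlog : Real.log (((N : ℝ) - 1) * δ) ≤ -6 := by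
      rw [Real.log_le_iff_le_exp (mul_pos hN1 hδ), mul_comm]
      exact ((lt_div_iff₀ hN1).1 hδ₀).le
  · obtain ⟨hpos, hup, hlow⟩ := H1_bounds hN hδ hlog hs
    exact ⟨(le_div_iff₀ hpos).2 hlow, (div_le_iff₀ hpos).2 hup⟩
  · rcases eq_or_ne s 0 with rfl | hs
    · simp [H1_zero]
    · obtain ⟨hpos, hup, hlow⟩ := H1_bounds hN hδ hlog hs
      exact ⟨hpos.le, by nlinarith, hup⟩
end

section
/- For every integer N ≥ 2 and every δ > 0, one has (1/N)|s|^N + ℋ₂(s) − (1/N)·ℋ₂'(s)·s ≥ 0 for all s ∈ ℝ, and moreover (1/N)|s|^N + ℋ₂(s) − (1/N)·ℋ₂'(s)·s > ((N−1)δ)^N/N for all s with |s| > (N−1)δ. -/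
lemma deriv_H2_eq_zero {N : ℕ} {δ s : ℝ} (ha : 0 < ((N : ℝ) - 1) * δ)
    (hs : |s| ≤ ((N : ℝ) - 1) * δ) : deriv (H2 N δ) s = 0 := by
  by_cases hd : DifferentiableAt ℝ (H2 N δ) s
  · have hmem : s ∈ Set.Icc (-(((N : ℝ) - 1) * δ)) (((N : ℝ) - 1) * δ) := abs_le.mp hs
    have huniq := uniqueDiffOn_Icc (neg_lt_self ha) s hmem
    refine huniq.eq_deriv _ hd.hasDerivAt.hasDerivWithinAt ?_
    refine (hasDerivWithinAt_const s _ (0 : ℝ)).congr_of_mem (fun x hx => ?_) hmem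
    exact if_pos (abs_le.mpr hx)
  · exact deriv_zero_of_not_differentiableAt hd

/-- Outside the zero set, `s * H2'(s)` is the radial derivative in closed form. -/
lemma deriv_H2_mul_self {N : ℕ} (hN : 2 ≤ N) {δ s : ℝ} (hδ : 0 < δ)
    (hs : ((N : ℝ) - 1) * δ < |s|) :
    deriv (H2 N δ) s * s =
      |s| ^ N * Real.log (|s| ^ N / (((N : ℝ) - 1) * δ) ^ N)
        + (N : ℝ) * (((N : ℝ) - 1) * δ) * |s| ^ (N - 1) - (N : ℝ) * |s| ^ N := by
  obtain ⟨n, rfl⟩ : ∃ n, N = n + 2 := ⟨N - 2, by omega⟩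
  have ha : 0 < (((n + 2 : ℕ) : ℝ) - 1) * δ := by
    refine mul_pos ?_ hδ
    push_cast
    linarith [(Nat.cast_nonneg n : (0 : ℝ) ≤ n)]
  set a : ℝ := (((n + 2 : ℕ) : ℝ) - 1) * δ with ha_def
  have ht : 0 < |s| := ha.trans hs
  have heq : H2 (n + 2) δ =ᶠ[nhds s] fun x =>
      (fun t : ℝ => (1 / ((n + 2 : ℕ) : ℝ)) * t ^ (n + 2) * Real.log (t ^ (n + 2) / a ^ (n + 2))
        + ((n + 2 : ℕ) : ℝ) * δ * t ^ (n + 1)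
        - ((((n + 2 : ℕ) : ℝ) + 1) / ((n + 2 : ℕ) : ℝ)) * t ^ (n + 2)
        - a ^ (n + 2) / (((n + 2 : ℕ) : ℝ) * (((n + 2 : ℕ) : ℝ) - 1))) |x| := by
    filter_upwards [(isOpen_lt continuous_const continuous_abs).mem_nhds hs] with x hx
    exact if_neg (not_le.mpr hx)
  have hpow := hasDerivAt_pow (n + 2) |s|
  have hlog := (hpow.div_const (a ^ (n + 2))).log (by positivity)
  have hrad := ((((hpow.const_mul (1 / ((n + 2 : ℕ) : ℝ))).mul hlog).add
    ((hasDerivAt_pow (n + 1) |s|).const_mul (((n + 2 : ℕ) : ℝ) * δ))).sub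
    (hpow.const_mul ((((n + 2 : ℕ) : ℝ) + 1) / ((n + 2 : ℕ) : ℝ)))).sub_const
    (a ^ (n + 2) / (((n + 2 : ℕ) : ℝ) * (((n + 2 : ℕ) : ℝ) - 1)))
  have hderiv := (hrad.comp s (hasDerivAt_abs (abs_pos.mp ht))).congr_of_eventuallyEq heq
  rw [hderiv.deriv, mul_assoc, sign_mul_self]
  generalize Real.log (|s| ^ (n + 2) / a ^ (n + 2)) = L
  simp only [Nat.add_sub_cancel, show n + 2 - 1 = n + 1 by omega]
  have ha_ne := ha.ne'
  have hnn : (n : ℝ) + 2 ≠ 0 := by positivity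
  rw [show (((n + 2 : ℕ) : ℝ)) * a = ((n + 2 : ℕ) : ℝ) * ((n + 1) * δ) by
    rw [ha_def]; push_cast; ring]
  clear_value a
  push_cast
  field_simp
  ring

lemma energy_H2_eq {N : ℕ} (hN : 2 ≤ N) {δ s : ℝ} (hδ : 0 < δ)
    (hs : ((N : ℝ) - 1) * δ < |s|) :
    (1 / (N : ℝ)) * |s| ^ N + H2 N δ s - (1 / (N : ℝ)) * deriv (H2 N δ) s * s =
      δ * |s| ^ (N - 1) - (((N : ℝ) - 1) * δ) ^ N / ((N : ℝ) * ((N : ℝ) - 1)) := by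
  have hN0 : (N : ℝ) ≠ 0 := by positivity
  rw [mul_assoc (1 / (N : ℝ)) (deriv _ _), deriv_H2_mul_self hN hδ hs, H2, if_neg (not_le.mpr hs)]
  generalize Real.log _ = L
  generalize (((N : ℝ) - 1) * δ) ^ N / ((N : ℝ) * ((N : ℝ) - 1)) = c
  field_simp
  ring

lemma lt_energy_H2 {N : ℕ} (hN : 2 ≤ N) {δ s : ℝ} (hδ : 0 < δ)
    (hs : ((N : ℝ) - 1) * δ < |s|) :
    (((N : ℝ) - 1) * δ) ^ N / (N : ℝ) <
      (1 / (N : ℝ)) * |s| ^ N + H2 N δ s - (1 / (N : ℝ)) * deriv (H2 N δ) s * s := by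
  rw [energy_H2_eq hN hδ hs]
  have hN1 : (0 : ℝ) < (N : ℝ) - 1 := by
    have : (2 : ℝ) ≤ N := by exact_mod_cast hN
    linarith
  have hN0 : (N : ℝ) ≠ 0 := by positivity
  have hpow : (((N : ℝ) - 1) * δ) ^ (N - 1) < |s| ^ (N - 1) :=
    pow_lt_pow_left₀ hs (by positivity) (by omega)
  have hsplit : (((N : ℝ) - 1) * δ) ^ N =
      (((N : ℝ) - 1) * δ) ^ (N - 1) * (((N : ℝ) - 1) * δ) := by
    rw [← pow_succ, Nat.sub_add_cancel (by omega)]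
  calc (((N : ℝ) - 1) * δ) ^ N / (N : ℝ)
      = δ * (((N : ℝ) - 1) * δ) ^ (N - 1)
          - (((N : ℝ) - 1) * δ) ^ N / ((N : ℝ) * ((N : ℝ) - 1)) := by
        rw [hsplit]
        generalize (((N : ℝ) - 1) * δ) ^ (N - 1) = p
        have := hN1.ne'
        field_simp
    _ < _ := by gcongr

/-- `(1/N)|s|^N + H2(s) − (1/N)H2'(s)s ≥ 0` for all `s`, with the strict bound
`> ((N−1)δ)^N/N` whenever `|s| > (N−1)δ`. -/
theorem stmt_16 (N : ℕ) (hN : 2 ≤ N) (δ : ℝ) (hδ : 0 < δ) :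
    (∀ s : ℝ,
      0 ≤ (1 / (N : ℝ)) * |s| ^ N + H2 N δ s - (1 / (N : ℝ)) * deriv (H2 N δ) s * s) ∧
    (∀ s : ℝ, ((N : ℝ) - 1) * δ < |s| →
      (((N : ℝ) - 1) * δ) ^ N / (N : ℝ) <
        (1 / (N : ℝ)) * |s| ^ N + H2 N δ s - (1 / (N : ℝ)) * deriv (H2 N δ) s * s) := by
  have ha : 0 < ((N : ℝ) - 1) * δ := by
    have : (2 : ℝ) ≤ N := by exact_mod_cast hN
    exact mul_pos (by linarith) hδ
  refine ⟨fun s => ?_, fun s hs => lt_energy_H2 hN hδ hs⟩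
  rcases le_or_gt |s| (((N : ℝ) - 1) * δ) with hs | hs
  · rw [deriv_H2_eq_zero ha hs, H2, if_pos hs, mul_zero, zero_mul, sub_zero, add_zero]
    positivity
  · exact le_trans (by positivity) (lt_energy_H2 hN hδ hs).le
end
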